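/- Dual attainment (Theorem 3.2): For every ρ ∈ ℝ^L with 0 ≤ ρ_p ≤ 1 for all p, the supremum of the dual 2-marginal SDP is attained: there exist a symmetric positive semidefinite Y* ∈ ℝ^{2L×2L} and vectors φ*_pq, ψ*_pq ∈ ℝ² satisfying φ*_pq 1₂ᵀ + 1₂ ψ*_pqᵀ ≤ C_pq − Y*_pq entrywise for all p < q, whose dual objective value F(Y*, {φ*_pq, ψ*_pq}) equals the optimal value E_sdp[ρ] of the primal 2-marginal SDP. -/

import Mathlib

open Matrix BigOperators

noncomputable section

abbrev Idx (L : ℕ) := Fin L × Fin 2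

/-- The fixed 1-marginal `μ_p^(1) = (1 - ρ_p, ρ_p)ᵀ`. -/
def mu1 {L : ℕ} (ρ : Fin L → ℝ) (p : Fin L) (t : Fin 2) : ℝ :=
  if t = 0 then 1 - ρ p else ρ p

/-- Feasibility for the primal 2-marginal SDP. -/
def PrimalFeasible {L : ℕ} (ρ : Fin L → ℝ) (M : Matrix (Idx L) (Idx L) ℝ) : Prop :=
  M.PosSemidef ∧
  (∀ p q : Fin L, p ≠ q → ∀ t u : Fin 2, 0 ≤ M (p, t) (q, u)) ∧
  (∀ p q : Fin L, p ≠ q → ∀ t : Fin 2, ∑ u : Fin 2, M (p, t) (q, u) = mu1 ρ p t) ∧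
  (∀ p : Fin L, ∀ t u : Fin 2, M (p, t) (p, u) = if t = u then mu1 ρ p t else 0)

/-- Feasibility for the dual 2-marginal SDP. -/
def DualFeasible {L : ℕ} (C Y : Matrix (Idx L) (Idx L) ℝ)
    (φ ψ : Fin L → Fin L → Fin 2 → ℝ) : Prop :=
  Y.PosSemidef ∧
  ∀ p q : Fin L, p < q → ∀ t u : Fin 2,
    φ p q t + ψ p q u ≤ C (p, t) (q, u) - Y (p, t) (q, u)

/-- The dual objective `F(Y, {φ_pq, ψ_pq})`. -/
def dualObj {L : ℕ} (ρ : Fin L → ℝ) (Y : Matrix (Idx L) (Idx L) ℝ)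
    (φ ψ : Fin L → Fin L → Fin 2 → ℝ) : ℝ :=
  2 * ∑ p : Fin L, ∑ q : Fin L,
      (if p < q then
        (∑ t : Fin 2, φ p q t * mu1 ρ p t) + (∑ u : Fin 2, ψ p q u * mu1 ρ q u)
       else 0)
    - ∑ p : Fin L, ∑ t : Fin 2, Y (p, t) (p, t) * mu1 ρ p t

/-- Set of objective values attained by primal feasible points. -/
def primalValues {L : ℕ} (ρ : Fin L → ℝ) (C : Matrix (Idx L) (Idx L) ℝ) : Set ℝ :=
  {x | ∃ M : Matrix (Idx L) (Idx L) ℝ, PrimalFeasible ρ M ∧ x = Matrix.trace (C * M)}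

/-- Set of objective values attained by dual feasible points. -/
def dualValues {L : ℕ} (ρ : Fin L → ℝ) (C : Matrix (Idx L) (Idx L) ℝ) : Set ℝ :=
  {x | ∃ Y φ ψ, DualFeasible C Y φ ψ ∧ x = dualObj ρ Y φ ψ}

/-- The set of matrices whose quadratic form is positive on nonzero vectors is open. -/
lemma isOpen_setOf_quadForm_pos {n : Type*} [Fintype n] :
    IsOpen {H : Matrix n n ℝ | ∀ x ∈ Metric.sphere (0 : n → ℝ) 1, 0 < x ⬝ᵥ H *ᵥ x} := by
  rw [isOpen_iff_mem_nhds]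
  intro H hH
  refine (isCompact_sphere (0 : n → ℝ) 1).eventually_forall_of_forall_eventually
    (P := fun (K : Matrix n n ℝ) (x : n → ℝ) => 0 < x ⬝ᵥ K *ᵥ x) fun x hx => ?_
  have hc : Continuous fun z : Matrix n n ℝ × (n → ℝ) => z.2 ⬝ᵥ z.1 *ᵥ z.2 := by fun_prop
  exact hc.continuousAt.eventually (lt_mem_nhds (hH x hx))

lemma quadForm_nonneg_of_pos_on_sphere {n : Type*} [Fintype n] {H : Matrix n n ℝ}
    (hH : ∀ x ∈ Metric.sphere (0 : n → ℝ) 1, 0 < x ⬝ᵥ H *ᵥ x) (x : n → ℝ) :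
    0 ≤ x ⬝ᵥ H *ᵥ x := by
  rcases eq_or_ne x 0 with rfl | hx
  · simp
  have hx' : ‖x‖ ≠ 0 := norm_ne_zero_iff.mpr hx
  have h := hH (‖x‖⁻¹ • x) (by simp [norm_smul, hx'])
  rw [mulVec_smul, smul_dotProduct, dotProduct_smul, smul_eq_mul, smul_eq_mul] at h
  have h2 : 0 < ‖x‖⁻¹ := by positivity
  exact (pos_of_mul_pos_right (pos_of_mul_pos_right h h2.le) h2.le).le

lemma nonpos_and_le_of_forall_add_mul_lt {a b u : ℝ} (h : ∀ t : ℝ, 0 < t → a + t * b < u) :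
    b ≤ 0 ∧ a ≤ u := by
  constructor
  · by_contra! hb
    have h1 := h ((|u - a| + 1) / b) (by positivity)
    rw [div_mul_cancel₀ _ hb.ne'] at h1
    linarith [le_abs_self (u - a)]
  · by_contra! ha
    have h1 := h ((a - u) / (|b| + 1)) (div_pos (by linarith) (by positivity))
    have h2 : -(a - u) ≤ (a - u) / (|b| + 1) * b := by
      rw [div_mul_eq_mul_div, le_div_iff₀ (by positivity)]
      nlinarith [neg_abs_le b]
    linarith

/-- Lagrange multipliers for a convex family of pairs (objective, matrix constraint) under
Slater's condition. -/
lemma exists_posSemidef_multiplier {n : Type*} [Fintype n] [DecidableEq n]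
    {A : Set (ℝ × Matrix n n ℝ)} (hA : Convex ℝ A) (hsymm : ∀ a ∈ A, a.2.IsSymm) {E : ℝ}
    (hE : ∀ a ∈ A, a.2.PosSemidef → E ≤ a.1) (hslater : ∃ a ∈ A, a.2.PosDef) :
    ∃ Y : Matrix n n ℝ, Y.PosSemidef ∧ ∀ a ∈ A, E ≤ a.1 - ∑ p, ∑ q, Y p q * a.2 p q := by
  set P : Set (Matrix n n ℝ) := {H | ∀ x ∈ Metric.sphere (0 : n → ℝ) 1, 0 < x ⬝ᵥ H *ᵥ x}
  have hPconv : Convex ℝ P := by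
    intro H hH K hK a b ha hb hab x hx
    have h1 := hH x hx
    have h2 := hK x hx
    simp only [add_mulVec, smul_mulVec, dotProduct_add, dotProduct_smul, smul_eq_mul]
    rcases ha.eq_or_lt with rfl | ha
    · obtain rfl : b = 1 := by linarith
      simpa using h2
    · have := mul_pos ha h1
      have := mul_nonneg hb h2.le
      linarith
  have hdisj : Disjoint (Set.Iio E ×ˢ P) A := by
    rw [Set.disjoint_left]
    rintro a ⟨ha1, ha2⟩ haA
    refine absurd (hE a haA ?_) (not_le.mpr ha1)
    refine PosSemidef.of_dotProduct_mulVec_nonneg ?_ fun x => ?_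
    · exact (conjTranspose_eq_transpose_of_trivial _).trans (hsymm a haA)
    · simpa using quadForm_nonneg_of_pos_on_sphere ha2 x
  obtain ⟨f, u, hf1, hf2⟩ := geometric_hahn_banach_open ((convex_Iio E).prod hPconv)
    (isOpen_Iio.prod isOpen_setOf_quadForm_pos) hA hdisj
  set l : ℝ := f (1, 0)
  set Z : Matrix n n ℝ := fun p q => f (0, single p q 1)
  have hf : ∀ r H, f (r, H) = r * l + ∑ p, ∑ q, H p q * Z p q := by
    intro r H
    have h1 : ((r, H) : ℝ × Matrix n n ℝ) =
        r • (1, 0) + ContinuousLinearMap.inr ℝ ℝ (Matrix n n ℝ) H := by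
      ext <;> simp
    have h2 : f (ContinuousLinearMap.inr ℝ ℝ (Matrix n n ℝ) H) = ∑ p, ∑ q, H p q * Z p q := by
      conv_lhs => rw [matrix_eq_sum_single H]
      simp only [map_sum]
      refine Finset.sum_congr rfl fun p _ => Finset.sum_congr rfl fun q _ => ?_
      have : single p q (H p q) = H p q • single p q (1 : ℝ) := by simp [smul_single]
      rw [this, map_smul, map_smul, smul_eq_mul]
      rfl
    rw [h1, map_add, map_smul, h2, smul_eq_mul]
  have hmem : ∀ s : ℝ, 0 < s → ∀ ε : ℝ, 0 < ε → ∀ t : ℝ, 0 < t → ∀ x : n → ℝ,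
      (E - s, t • vecMulVec x x + ε • (1 : Matrix n n ℝ)) ∈ Set.Iio E ×ˢ P := by
    intro s hs ε hε t ht x
    refine ⟨by simpa using hs, fun y hy => ?_⟩
    have hy0 : y ≠ 0 := by
      rintro rfl
      simp at hy
    have h1 : 0 < y ⬝ᵥ y := by simpa using (dotProduct_star_self_pos_iff (v := y)).mpr hy0
    have h2 : y ⬝ᵥ vecMulVec x x *ᵥ y = (x ⬝ᵥ y) ^ 2 := by
      rw [vecMulVec_mulVec, dotProduct_comm x y]
      simp [sq, dotProduct_comm]
    simp only [add_mulVec, smul_mulVec, dotProduct_add, dotProduct_smul, smul_eq_mul, one_mulVec,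
      h2]
    positivity
  have hlt : ∀ s : ℝ, 0 < s → ∀ ε : ℝ, 0 < ε → ∀ t : ℝ, 0 < t → ∀ x : n → ℝ,
      (E * l + t * (∑ p, ∑ q, x p * x q * Z p q)) + ε * (∑ p, Z p p) + s * -l < u := by
    intro s hs ε hε t ht x
    have h := hf1 _ (hmem s hs ε hε t ht x)
    rw [hf] at h
    have h3 : ∑ p, ∑ q, (t • vecMulVec x x + ε • (1 : Matrix n n ℝ)) p q * Z p q =
        t * (∑ p, ∑ q, x p * x q * Z p q) + ε * (∑ p, Z p p) := by
      simp [add_mul, Finset.sum_add_distrib, Finset.mul_sum, vecMulVec_apply, one_apply, mul_assoc]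
    rw [h3] at h
    linarith
  have hl : 0 ≤ l := by
    have := (nonpos_and_le_of_forall_add_mul_lt
      fun s hs => hlt s hs 1 one_pos 1 one_pos 0).1
    linarith
  have hZt : ∀ x : n → ℝ, ∀ t : ℝ, 0 < t → E * l + t * (∑ p, ∑ q, x p * x q * Z p q) < u + 1 := by
    intro x t ht
    have := (nonpos_and_le_of_forall_add_mul_lt fun ε hε =>
      lt_of_le_of_lt (nonpos_and_le_of_forall_add_mul_lt
        fun s hs => hlt s hs ε hε t ht x).2 (lt_add_of_pos_right u one_half_pos)).2
    linarith
  have hZ : ∀ x : n → ℝ, ∑ p, ∑ q, x p * x q * Z p q ≤ 0 := fun x =>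
    (nonpos_and_le_of_forall_add_mul_lt (hZt x)).1
  have hEu : E * l ≤ u := by
    refine le_of_forall_pos_lt_add fun δ hδ => ?_
    have := (nonpos_and_le_of_forall_add_mul_lt fun ε hε =>
      lt_of_le_of_lt (nonpos_and_le_of_forall_add_mul_lt
        fun s hs => hlt s hs ε hε 1 one_pos 0).2 (lt_add_of_pos_right u (half_pos hδ))).2
    simp at this
    linarith
  have hlpos : 0 < l := by
    refine hl.lt_of_ne fun h0 => ?_
    obtain ⟨a, ha, hpd⟩ := hslater
    have h1 := hf2 a ha
    have h2 := hf1 (E - 1, a.2) ⟨by simp, fun x hx => by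
      have hx0 : x ≠ 0 := by
        rintro rfl
        simp at hx
      simpa using hpd.dotProduct_mulVec_pos hx0⟩
    rw [hf] at h2
    rw [show a = (a.1, a.2) from rfl, hf] at h1
    rw [← h0] at h1 h2
    linarith
  refine ⟨(-(2 * l)⁻¹) • (Z + Zᵀ), ?_, fun a ha => ?_⟩
  · refine PosSemidef.of_dotProduct_mulVec_nonneg ?_ fun x => ?_
    · simp [IsHermitian, conjTranspose_eq_transpose_of_trivial, add_comm]
    · have h1 : x ⬝ᵥ Z *ᵥ x = ∑ p, ∑ q, x p * x q * Z p q := by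
        simp only [dotProduct, mulVec, Finset.mul_sum]
        exact Finset.sum_congr rfl fun p _ => Finset.sum_congr rfl fun q _ => by ring
      have h2 : x ⬝ᵥ Zᵀ *ᵥ x = x ⬝ᵥ Z *ᵥ x := by
        rw [mulVec_transpose, dotProduct_comm, dotProduct_mulVec]
      have h3 : 0 ≤ (2 * l)⁻¹ := by positivity
      simp only [star_trivial, smul_mulVec, add_mulVec, dotProduct_smul, dotProduct_add, h2, h1,
        smul_eq_mul]
      nlinarith [mul_nonneg h3 (neg_nonneg.mpr (hZ x))]
  · have h1 := hf2 a ha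
    rw [show a = (a.1, a.2) from rfl, hf] at h1
    have h2 : ∑ p, ∑ q, a.2 p q * Z q p = ∑ p, ∑ q, a.2 p q * Z p q := by
      rw [Finset.sum_comm]
      refine Finset.sum_congr rfl fun p _ => Finset.sum_congr rfl fun q _ => ?_
      rw [(hsymm a ha).apply]
    have h3 : ∑ p, ∑ q, ((-(2 * l)⁻¹) • (Z + Zᵀ)) p q * a.2 p q =
        -(2 * l)⁻¹ * (∑ p, ∑ q, a.2 p q * Z p q + ∑ p, ∑ q, a.2 p q * Z q p) := by
      simp only [← Finset.sum_add_distrib, Finset.mul_sum]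
      refine Finset.sum_congr rfl fun p _ => Finset.sum_congr rfl fun q _ => ?_
      simp
      ring
    rw [h3, h2]
    set W := ∑ p, ∑ q, a.2 p q * Z p q
    have h4 : a.1 - -(2 * l)⁻¹ * (W + W) = (a.1 * l + W) / l := by
      field_simp
      ring
    rw [h4, le_div_iff₀ hlpos]
    linarith

lemma Matrix.PosSemidef.trace_mul_nonneg {n : Type*} [Fintype n] {A B : Matrix n n ℝ}
    (hA : A.PosSemidef) (hB : B.PosSemidef) : 0 ≤ trace (A * B) := by
  obtain ⟨m, v, rfl⟩ := posSemidef_iff_eq_sum_vecMulVec.mp hB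
  rw [Finset.mul_sum, trace_sum]
  refine Finset.sum_nonneg fun i _ => ?_
  rw [mul_vecMulVec, trace_vecMulVec, dotProduct_comm]
  exact hA.dotProduct_mulVec_nonneg _

/-- The perturbation direction of a `2 × 2` coupling with fixed marginals. -/
def couplingSign (t : Fin 2) : ℝ := if t = 0 then -1 else 1

/-- Dual attainment for the `2 × 2` optimal transport problem. -/
lemma exists_coupling_potentials {μ ν : Fin 2 → ℝ} (hμ : ∀ t, 0 ≤ μ t) (hν : ∀ t, 0 ≤ ν t)
    (hμ1 : ∑ t, μ t = 1) (hν1 : ∑ t, ν t = 1) (c : Fin 2 → Fin 2 → ℝ) :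
    ∃ (γ : ℝ) (φ ψ : Fin 2 → ℝ),
      (∀ t u, 0 ≤ μ t * ν u + couplingSign t * couplingSign u * γ) ∧
      (∀ t u, φ t + ψ u ≤ c t u) ∧
      ∑ t, φ t * μ t + ∑ u, ψ u * ν u =
        ∑ t, ∑ u, c t u * (μ t * ν u + couplingSign t * couplingSign u * γ) := by
  have h0 := hμ 0
  have h1 := hμ 1
  have h2 := hν 0
  have h3 := hν 1
  simp only [Fin.sum_univ_two, Fin.forall_fin_two, couplingSign] at *
  obtain ⟨a, ha⟩ : ∃ a, μ 1 = a := ⟨_, rfl⟩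
  obtain ⟨b, hb⟩ : ∃ b, ν 1 = b := ⟨_, rfl⟩
  have ha' : μ 0 = 1 - a := by linarith
  have hb' : ν 0 = 1 - b := by linarith
  rw [ha'] at h0
  rw [ha] at h1
  rw [hb'] at h2
  rw [hb] at h3
  rw [ha, ha', hb, hb']
  clear hμ1 hν1 ha ha' hb hb' hμ hν
  rcases le_total (c 0 1 + c 1 0) (c 0 0 + c 1 1) with hc | hc
  · rcases le_total (a + b) 1 with hab | hab
    · refine ⟨-(a * b), ![0, c 1 0 - c 0 0], ![c 0 0, c 0 1], ?_, ?_, ?_⟩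
      · norm_num
        refine ⟨⟨?_, ?_⟩, ?_⟩ <;> nlinarith
      · norm_num
        linarith
      · norm_num
        ring
    · refine ⟨-((1 - a) * (1 - b)), ![c 0 1 - c 1 1, 0], ![c 1 0, c 1 1], ?_, ?_, ?_⟩
      · norm_num
        refine ⟨?_, ?_, ?_⟩ <;> nlinarith
      · norm_num
        linarith
      · norm_num
        ring
  · rcases le_total a b with hab | hab
    · refine ⟨a * (1 - b), ![0, c 1 1 - c 0 1], ![c 0 0, c 0 1], ?_, ?_, ?_⟩
      · norm_num
        refine ⟨⟨?_, ?_⟩, ?_⟩ <;> nlinarith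
      · norm_num
        linarith
      · norm_num
        ring
    · refine ⟨(1 - a) * b, ![0, c 1 0 - c 0 0], ![c 0 0, c 1 1 + c 0 0 - c 1 0], ?_, ?_, ?_⟩
      · norm_num
        refine ⟨?_, ?_, ?_⟩ <;> nlinarith
      · norm_num
        linarith
      · norm_num
        ring

lemma sum_sum_eq_two_mul_sum_lt_add_diag {ι : Type*} [Fintype ι] [LinearOrder ι]
    {h : ι → ι → ℝ} (hs : ∀ p q, h p q = h q p) :
    ∑ p, ∑ q, h p q = 2 * ∑ p, ∑ q, (if p < q then h p q else 0) + ∑ p, h p p := by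
  have h1 : ∀ p q, h p q = (if p < q then h p q else 0) + (if q < p then h q p else 0) +
      (if p = q then h p p else 0) := by
    intro p q
    rcases lt_trichotomy p q with hpq | rfl | hpq
    · simp [hpq, hpq.not_gt, hpq.ne]
    · simp
    · simp [hpq, hpq.not_gt, hpq.ne', hs p q]
  rw [Finset.sum_congr rfl fun p _ => Finset.sum_congr rfl fun q _ => h1 p q]
  simp only [Finset.sum_add_distrib]
  rw [Finset.sum_comm (f := fun p q => if q < p then h q p else 0)]
  simp
  ring

lemma sum_mu1 {L : ℕ} (ρ : Fin L → ℝ) (p : Fin L) : ∑ t, mu1 ρ p t = 1 := by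
  simp [mu1]

lemma mu1_nonneg {L : ℕ} {ρ : Fin L → ℝ} (hρ : ∀ p, 0 ≤ ρ p ∧ ρ p ≤ 1) (p : Fin L) (t : Fin 2) :
    0 ≤ mu1 ρ p t := by
  unfold mu1
  split_ifs
  · linarith [(hρ p).2]
  · exact (hρ p).1

/-- The matrix of pairwise couplings with marginals `μ_p^(1)` and covariances `g`. -/
def couplingMatrix {L : ℕ} (ρ : Fin L → ℝ) (g : Matrix (Fin L) (Fin L) ℝ) :
    Matrix (Idx L) (Idx L) ℝ :=
  of fun a b => mu1 ρ a.1 a.2 * mu1 ρ b.1 b.2 + couplingSign a.2 * couplingSign b.2 * g a.1 b.1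

/-- The covariance matrices of families of pairwise couplings, without the semidefinite
constraint. -/
def couplingCovariances {L : ℕ} (ρ : Fin L → ℝ) : Set (Matrix (Fin L) (Fin L) ℝ) :=
  {g | g.IsSymm ∧ (∀ p, g p p = ρ p * (1 - ρ p)) ∧
    ∀ p q, p ≠ q → ∀ t u, 0 ≤ couplingMatrix ρ g (p, t) (q, u)}

lemma couplingMatrix_isSymm {L : ℕ} (ρ : Fin L → ℝ) {g : Matrix (Fin L) (Fin L) ℝ}
    (hg : g.IsSymm) : (couplingMatrix ρ g).IsSymm := by
  refine IsSymm.ext fun a b => ?_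
  simp only [couplingMatrix, of_apply, hg.apply a.1 b.1]
  ring

lemma couplingMatrix_diag {L : ℕ} {ρ : Fin L → ℝ} {g : Matrix (Fin L) (Fin L) ℝ}
    (hg : ∀ p, g p p = ρ p * (1 - ρ p)) (p : Fin L) (t u : Fin 2) :
    couplingMatrix ρ g (p, t) (p, u) = if t = u then mu1 ρ p t else 0 := by
  fin_cases t <;> fin_cases u <;> simp [couplingMatrix, hg, mu1, couplingSign] <;> ring

lemma primalFeasible_couplingMatrix {L : ℕ} {ρ : Fin L → ℝ} {g : Matrix (Fin L) (Fin L) ℝ}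
    (hg : g ∈ couplingCovariances ρ) (hpsd : g.PosSemidef) :
    PrimalFeasible ρ (couplingMatrix ρ g) := by
  obtain ⟨hsymm, hdiag, hpos⟩ := hg
  refine ⟨?_, hpos, fun p q _ t => ?_, couplingMatrix_diag hdiag⟩
  · let B : Matrix (Idx L) (Fin L) ℝ :=
      of fun a p => if a.1 = p then couplingSign a.2 else 0
    have h : couplingMatrix ρ g =
        vecMulVec (fun a : Idx L => mu1 ρ a.1 a.2) (star fun a : Idx L => mu1 ρ a.1 a.2) +
          B * g * Bᴴ := by
      ext a b
      simp [couplingMatrix, vecMulVec_apply, B, Matrix.mul_apply]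
      ring
    rw [h]
    exact (posSemidef_vecMulVec_self_star _).add (hpsd.mul_mul_conjTranspose_same B)
  · have := sum_mu1 ρ q
    simp only [Fin.sum_univ_two] at this
    simp [couplingMatrix, Fin.sum_univ_two, couplingSign]
    linear_combination mu1 ρ p t * this

lemma diagonal_mem_couplingCovariances {L : ℕ} {ρ : Fin L → ℝ} (hρ : ∀ p, 0 ≤ ρ p ∧ ρ p ≤ 1) :
    diagonal (fun p => ρ p * (1 - ρ p)) ∈ couplingCovariances ρ := by
  refine ⟨diagonal_transpose _, by simp, fun p q hpq t u => ?_⟩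
  simpa [couplingMatrix, hpq] using mul_nonneg (mu1_nonneg hρ p t) (mu1_nonneg hρ q u)

/-- Frobenius inner product of the `(p, q)` blocks. -/
def blockInner {L : ℕ} (A M : Matrix (Idx L) (Idx L) ℝ) (p q : Fin L) : ℝ :=
  ∑ t, ∑ u, A (p, t) (q, u) * M (p, t) (q, u)

lemma trace_mul_eq_sum_blockInner {L : ℕ} (A : Matrix (Idx L) (Idx L) ℝ)
    {M : Matrix (Idx L) (Idx L) ℝ} (hM : M.IsSymm) :
    trace (A * M) = ∑ p, ∑ q, blockInner A M p q := by
  simp only [trace, diag_apply, Matrix.mul_apply, Fintype.sum_prod_type, blockInner]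
  refine Finset.sum_congr rfl fun p _ => ?_
  rw [Finset.sum_comm]
  refine Finset.sum_congr rfl fun q _ => Finset.sum_congr rfl fun t _ =>
    Finset.sum_congr rfl fun u _ => ?_
  rw [hM.apply]

lemma trace_mul_sub_trace_mul {L : ℕ} {ρ : Fin L → ℝ} {C Y M : Matrix (Idx L) (Idx L) ℝ}
    (hC : C.IsSymm) (hC0 : ∀ p : Fin L, ∀ t u : Fin 2, C (p, t) (p, u) = 0) (hY : Y.IsSymm)
    (hM : M.IsSymm)
    (hdiag : ∀ p : Fin L, ∀ t u : Fin 2, M (p, t) (p, u) = if t = u then mu1 ρ p t else 0) :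
    trace (C * M) - trace (Y * M) =
      2 * ∑ p, ∑ q, (if p < q then blockInner (C - Y) M p q else 0) -
        ∑ p, ∑ t, Y (p, t) (p, t) * mu1 ρ p t := by
  rw [← trace_sub, ← Matrix.sub_mul, trace_mul_eq_sum_blockInner _ hM,
    sum_sum_eq_two_mul_sum_lt_add_diag, sub_eq_add_neg _ (∑ p, _), ← Finset.sum_neg_distrib]
  · congr 1
    refine Finset.sum_congr rfl fun p _ => ?_
    simp [blockInner, hdiag, hC0]
  · intro p q
    unfold blockInner
    rw [Finset.sum_comm]
    refine Finset.sum_congr rfl fun t _ => Finset.sum_congr rfl fun u _ => ?_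
    rw [hM.apply, (hC.sub hY).apply]

lemma Matrix.PosSemidef.isSymm_of_real {n : Type*} {A : Matrix n n ℝ} (hA : A.PosSemidef) :
    A.IsSymm :=
  (conjTranspose_eq_transpose_of_trivial A).symm.trans hA.isHermitian

/-- Weak duality. -/
lemma dualObj_le_trace {L : ℕ} {ρ : Fin L → ℝ} {C Y M : Matrix (Idx L) (Idx L) ℝ}
    {φ ψ : Fin L → Fin L → Fin 2 → ℝ} (hC : C.IsSymm)
    (hC0 : ∀ p : Fin L, ∀ t u : Fin 2, C (p, t) (p, u) = 0)
    (hD : DualFeasible C Y φ ψ) (hM : PrimalFeasible ρ M) :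
    dualObj ρ Y φ ψ ≤ trace (C * M) := by
  obtain ⟨hY, hle⟩ := hD
  obtain ⟨hpsd, hpos, hmarg, hdiag⟩ := hM
  have hMs := hpsd.isSymm_of_real
  have h1 := trace_mul_sub_trace_mul (ρ := ρ) hC hC0 hY.isSymm_of_real hMs hdiag
  have h2 := hY.trace_mul_nonneg hpsd
  have h3 : dualObj ρ Y φ ψ ≤ 2 * ∑ p, ∑ q, (if p < q then blockInner (C - Y) M p q else 0) -
      ∑ p, ∑ t, Y (p, t) (p, t) * mu1 ρ p t := by
    unfold dualObj
    gcongr with p _ q _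
    split_ifs with hpq
    · have h4 : ∀ u, ∑ t, M (p, t) (q, u) = mu1 ρ q u := fun u => by
        rw [← hmarg q p hpq.ne' u]
        exact Finset.sum_congr rfl fun t _ => hMs.apply _ _
      calc (∑ t, φ p q t * mu1 ρ p t) + ∑ u, ψ p q u * mu1 ρ q u
          = ∑ t, ∑ u, (φ p q t + ψ p q u) * M (p, t) (q, u) := by
            simp only [← h4, ← hmarg p q hpq.ne, add_mul, Finset.sum_add_distrib, Finset.mul_sum]
            rw [Finset.sum_comm (f := fun u t => ψ p q u * M (p, t) (q, u))]
        _ ≤ blockInner (C - Y) M p q := by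
            unfold blockInner
            gcongr with t _ u _
            · exact hpos p q hpq.ne t u
            · exact hle p q hpq t u
    · exact le_rfl
  linarith

/-- For a fixed semidefinite multiplier, the remaining dual problem splits into pairwise optimal
transport problems, whose dual optima are attained. -/
lemma exists_dualObj_eq_trace_sub {L : ℕ} {ρ : Fin L → ℝ} (hρ : ∀ p, 0 ≤ ρ p ∧ ρ p ≤ 1)
    {C Y : Matrix (Idx L) (Idx L) ℝ} (hC : C.IsSymm)
    (hC0 : ∀ p : Fin L, ∀ t u : Fin 2, C (p, t) (p, u) = 0) (hY : Y.PosSemidef) :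
    ∃ φ ψ, DualFeasible C Y φ ψ ∧ ∃ g ∈ couplingCovariances ρ,
      dualObj ρ Y φ ψ = trace (C * couplingMatrix ρ g) - trace (Y * couplingMatrix ρ g) := by
  choose γ φ ψ hpos hle hval using fun p q : Fin L =>
    exists_coupling_potentials (mu1_nonneg hρ p) (mu1_nonneg hρ q) (sum_mu1 ρ p) (sum_mu1 ρ q)
      (fun t u => (C - Y) (p, t) (q, u))
  let g : Matrix (Fin L) (Fin L) ℝ :=
    of fun p q => if p < q then γ p q else if q < p then γ q p else ρ p * (1 - ρ p)
  have hg : g.IsSymm := by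
    refine IsSymm.ext fun p q => ?_
    rcases lt_trichotomy p q with h | rfl | h
    · simp [g, h, h.not_gt]
    · rfl
    · simp [g, h, h.not_gt]
  have hgd : ∀ p, g p p = ρ p * (1 - ρ p) := by simp [g]
  have hlt : ∀ p q, p < q → ∀ t u, couplingMatrix ρ g (p, t) (q, u) =
      mu1 ρ p t * mu1 ρ q u + couplingSign t * couplingSign u * γ p q := by
    intro p q h t u
    simp [couplingMatrix, g, h]
  have hs := couplingMatrix_isSymm ρ hg
  refine ⟨φ, ψ, ⟨hY, fun p q _ => hle p q⟩, g, ⟨hg, hgd, fun p q hpq t u => ?_⟩, ?_⟩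
  · rcases hpq.lt_or_gt with h | h
    · rw [hlt p q h]
      exact hpos p q t u
    · rw [← hs.apply, hlt q p h]
      exact hpos q p u t
  · rw [trace_mul_sub_trace_mul (ρ := ρ) hC hC0 hY.isSymm_of_real hs (couplingMatrix_diag hgd)]
    unfold dualObj
    congr 2
    refine Finset.sum_congr rfl fun p _ => Finset.sum_congr rfl fun q _ => ?_
    split_ifs with h
    · simp only [hval, blockInner, hlt p q h]
    · rfl

/-- The lift of a multiplier for the covariance constraint to one for the `2`-marginal matrix. -/
lemma exists_posSemidef_lift {L : ℕ} (ρ : Fin L → ℝ) {Z : Matrix (Fin L) (Fin L) ℝ}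
    (hZ : Z.PosSemidef) :
    ∃ Y : Matrix (Idx L) (Idx L) ℝ, Y.PosSemidef ∧ ∀ g : Matrix (Fin L) (Fin L) ℝ, g.IsSymm →
      trace (Y * couplingMatrix ρ g) = ∑ p, ∑ q, Z p q * g p q := by
  let w : Idx L → ℝ := fun a => if a.2 = 0 then -ρ a.1 else 1 - ρ a.1
  let B : Matrix (Idx L) (Fin L) ℝ := of fun a p => if a.1 = p then w a else 0
  refine ⟨B * Z * Bᴴ, hZ.mul_mul_conjTranspose_same B, fun g hg => ?_⟩
  rw [trace_mul_eq_sum_blockInner _ (couplingMatrix_isSymm ρ hg)]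
  refine Finset.sum_congr rfl fun p _ => Finset.sum_congr rfl fun q _ => ?_
  simp [blockInner, B, w, Matrix.mul_apply, couplingMatrix, couplingSign, mu1]
  ring

lemma couplingMatrix_combo {L : ℕ} (ρ : Fin L → ℝ) (g h : Matrix (Fin L) (Fin L) ℝ) {a b : ℝ}
    (hab : a + b = 1) :
    couplingMatrix ρ (a • g + b • h) = a • couplingMatrix ρ g + b • couplingMatrix ρ h := by
  obtain rfl : b = 1 - a := by linarith
  ext x y
  simp [couplingMatrix]
  ring

lemma convex_couplingCovariances {L : ℕ} (ρ : Fin L → ℝ) : Convex ℝ (couplingCovariances ρ) := by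
  rintro g ⟨hg1, hg2, hg3⟩ h ⟨hh1, hh2, hh3⟩ a b ha hb hab
  refine ⟨(hg1.smul a).add (hh1.smul b), fun p => ?_, fun p q hpq t u => ?_⟩
  · simp only [Matrix.add_apply, Matrix.smul_apply, hg2, hh2, smul_eq_mul]
    rw [← add_mul, hab, one_mul]
  · rw [couplingMatrix_combo ρ g h hab]
    have h1 := mul_nonneg ha (hg3 p q hpq t u)
    have h2 := mul_nonneg hb (hh3 p q hpq t u)
    simpa using add_nonneg h1 h2

lemma bddBelow_primalValues {L : ℕ} {ρ : Fin L → ℝ} (hρ : ∀ p, 0 ≤ ρ p ∧ ρ p ≤ 1)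
    {C : Matrix (Idx L) (Idx L) ℝ} (hC : C.IsSymm)
    (hC0 : ∀ p : Fin L, ∀ t u : Fin 2, C (p, t) (p, u) = 0) : BddBelow (primalValues ρ C) := by
  obtain ⟨φ, ψ, hD, -⟩ := exists_dualObj_eq_trace_sub hρ hC hC0 PosSemidef.zero
  refine ⟨dualObj ρ 0 φ ψ, ?_⟩
  rintro _ ⟨M, hM, rfl⟩
  exact dualObj_le_trace hC hC0 hD hM

/-- The rows of a coupling covariance at a deterministic variable vanish. -/
lemma couplingCovariances_apply_eq_zero {L : ℕ} {ρ : Fin L → ℝ} {g : Matrix (Fin L) (Fin L) ℝ}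
    (hg : g ∈ couplingCovariances ρ) {p : Fin L} (hp : ρ p * (1 - ρ p) = 0) (q : Fin L) :
    g p q = 0 := by
  rcases eq_or_ne p q with rfl | hpq
  · rw [hg.2.1, hp]
  have h := hg.2.2 p q hpq
  have h00 := h 0 0
  have h01 := h 0 1
  have h10 := h 1 0
  have h11 := h 1 1
  simp [couplingMatrix, mu1, couplingSign] at h00 h01 h10 h11
  rcases mul_eq_zero.mp hp with hp | hp
  · simp only [hp] at *
    linarith
  · obtain hp : ρ p = 1 := by linarith
    simp only [hp] at *
    linarith

/-- The projection onto deterministic variables, used to restore Slater's condition. -/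
def deterministicProj {L : ℕ} (ρ : Fin L → ℝ) : Matrix (Fin L) (Fin L) ℝ :=
  diagonal fun p => if ρ p * (1 - ρ p) = 0 then 1 else 0

lemma posSemidef_of_add_deterministicProj {L : ℕ} {ρ : Fin L → ℝ}
    {g : Matrix (Fin L) (Fin L) ℝ} (hg : g ∈ couplingCovariances ρ)
    (h : (g + deterministicProj ρ).PosSemidef) : g.PosSemidef := by
  let B : Matrix (Fin L) (Fin L) ℝ := diagonal fun p => if ρ p * (1 - ρ p) = 0 then 0 else 1
  have h1 : g = B * (g + deterministicProj ρ) * Bᴴ := by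
    ext p q
    simp only [B, deterministicProj, diagonal_conjTranspose, mul_diagonal, diagonal_mul,
      Matrix.add_apply, Pi.star_apply]
    by_cases hp : ρ p * (1 - ρ p) = 0
    · simp only [couplingCovariances_apply_eq_zero hg hp q, if_pos hp, zero_mul]
    · rw [diagonal_apply, if_neg hp, if_neg hp, ite_self, add_zero, one_mul]
      split_ifs with hq
      · rw [← hg.1.apply, couplingCovariances_apply_eq_zero hg hq p, zero_mul]
      · simp
  rw [h1]
  exact h.mul_mul_conjTranspose_same B

/-- Strong duality for the semidefinite constraint on the covariances. -/
lemma exists_covariance_multiplier {L : ℕ} {ρ : Fin L → ℝ} (hρ : ∀ p, 0 ≤ ρ p ∧ ρ p ≤ 1)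
    {C : Matrix (Idx L) (Idx L) ℝ} (hC : C.IsSymm)
    (hC0 : ∀ p : Fin L, ∀ t u : Fin 2, C (p, t) (p, u) = 0) :
    ∃ Z : Matrix (Fin L) (Fin L) ℝ, Z.PosSemidef ∧ ∀ g ∈ couplingCovariances ρ,
      sInf (primalValues ρ C) ≤ trace (C * couplingMatrix ρ g) - ∑ p, ∑ q, Z p q * g p q := by
  have hconv : Convex ℝ ((fun g => (trace (C * couplingMatrix ρ g), g + deterministicProj ρ)) ''
      couplingCovariances ρ) := by
    rintro _ ⟨g, hg, rfl⟩ _ ⟨h, hh, rfl⟩ a b ha hb hab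
    refine ⟨a • g + b • h, convex_couplingCovariances ρ hg hh ha hb hab, Prod.ext ?_ ?_⟩
    · simp [couplingMatrix_combo ρ g h hab, Matrix.mul_add]
    · simp only [Prod.smul_mk, Prod.mk_add_mk, smul_add]
      rw [add_add_add_comm, ← add_smul, hab, one_smul]
  obtain ⟨Z, hZ, hle⟩ := exists_posSemidef_multiplier hconv (E := sInf (primalValues ρ C))
    (by
      rintro _ ⟨g, hg, rfl⟩
      exact hg.1.add (diagonal_transpose _))
    (by
      rintro _ ⟨g, hg, rfl⟩ hpsd
      exact csInf_le (bddBelow_primalValues hρ hC hC0) ⟨_, primalFeasible_couplingMatrix hg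
        (posSemidef_of_add_deterministicProj hg hpsd), rfl⟩)
    (by
      refine ⟨_, ⟨_, diagonal_mem_couplingCovariances hρ, rfl⟩, ?_⟩
      simp only [deterministicProj, diagonal_add, posDef_diagonal_iff]
      intro p
      have := mul_nonneg (hρ p).1 (sub_nonneg.mpr (hρ p).2)
      split_ifs with h
      · linarith
      · simpa using this.lt_of_ne' h)
  refine ⟨Z, hZ, fun g hg => ?_⟩
  have h1 := hle _ ⟨g, hg, rfl⟩
  have h2 : 0 ≤ ∑ p, ∑ q, Z p q * deterministicProj ρ p q := by
    refine Finset.sum_nonneg fun p _ => ?_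
    simp only [deterministicProj, diagonal_apply, mul_ite, mul_zero, Finset.sum_ite_eq,
      Finset.mem_univ, if_true]
    split_ifs
    · simpa using hZ.diag_nonneg
    · exact le_rfl
  simp only [Matrix.add_apply, mul_add, Finset.sum_add_distrib] at h1
  linarith

/-- Dual attainment (Theorem 3.2): the supremum of the dual 2-marginal SDP is attained,
and the attained value equals the primal optimal value `E_sdp[ρ]`. -/
theorem dual_attainment (L : ℕ) (hL : 2 ≤ L) (ρ : Fin L → ℝ)
    (hρ : ∀ p, 0 ≤ ρ p ∧ ρ p ≤ 1)
    (C : Matrix (Idx L) (Idx L) ℝ) (hCsymm : C.IsSymm)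
    (hCdiag : ∀ p : Fin L, ∀ t u : Fin 2, C (p, t) (p, u) = 0) :
    ∃ (Y : Matrix (Idx L) (Idx L) ℝ) (φ ψ : Fin L → Fin L → Fin 2 → ℝ),
      DualFeasible C Y φ ψ ∧
      dualObj ρ Y φ ψ = sInf (primalValues ρ C) := by
  obtain ⟨Z, hZ, hle⟩ := exists_covariance_multiplier hρ hCsymm hCdiag
  obtain ⟨Y, hY, hYtr⟩ := exists_posSemidef_lift ρ hZ
  obtain ⟨φ, ψ, hD, g, hg, hval⟩ := exists_dualObj_eq_trace_sub hρ hCsymm hCdiag hY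
  refine ⟨Y, φ, ψ, hD, le_antisymm (le_csInf ?_ ?_) ?_⟩
  · have hpsd : (diagonal fun p => ρ p * (1 - ρ p)).PosSemidef :=
      PosSemidef.diagonal fun p => mul_nonneg (hρ p).1 (sub_nonneg.mpr (hρ p).2)
    exact ⟨_, _, primalFeasible_couplingMatrix (diagonal_mem_couplingCovariances hρ) hpsd, rfl⟩
  · rintro _ ⟨M, hM, rfl⟩
    exact dualObj_le_trace hCsymm hCdiag hD hM
  · rw [hval, hYtr g hg.1]
    exact hle g hg
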